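/- Let (A, 𝔪) be a two-dimensional excellent normal local domain over an algebraically closed field. Let I ⊆ A be an 𝔪-primary ideal whose Rees algebra 𝓡(I) = A[It] is a Cohen–Macaulay normal domain, and let J ⊆ A be any integrally closed 𝔪-primary ideal. Then there exist elements a ∈ I and b ∈ J such that IJ = aJ + bI. -/

import Mathlib

/-! Auxiliary definitions.

Mathlib does not yet know about excellent rings; the excellence hypothesis of the paper
is used only to guarantee the existence of resolutions and of the normal Hilbert
polynomial, which we hypothesize directly where needed. -/

/-- The length `ℓ_R(M)` of a module, defined as the Krull dimension of its lattice of
submodules (for modules of finite length this is the usual Jordan–Hölder length). -/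
noncomputable def moduleLength (R M : Type*) [CommRing R] [AddCommGroup M] [Module R M] :
    WithBot ℕ∞ :=
  Order.krullDim (Submodule R M)

/-- `x` is integral over the ideal `I`: it satisfies an equation of integral dependence
`x ^ n + c 1 * x ^ (n-1) + ⋯ + c n = 0` with `c i ∈ I ^ i`. -/
def IsIntegralOverIdeal {A : Type*} [CommRing A] (I : Ideal A) (x : A) : Prop :=
  ∃ n : ℕ, 0 < n ∧ ∃ c : ℕ → A, (∀ i, 1 ≤ i → i ≤ n → c i ∈ I ^ i) ∧
    x ^ n + ∑ i ∈ Finset.Icc 1 n, c i * x ^ (n - i) = 0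

/-- The integral closure `J̄` of an ideal `J`: the set of elements integral over `J`
(this set is an ideal; we take the ideal it generates). -/
noncomputable def idealIntegralClosure {A : Type*} [CommRing A] (I : Ideal A) : Ideal A :=
  Ideal.span {x | IsIntegralOverIdeal I x}

/-- An ideal is integrally closed if it contains every element integral over it. -/
def IdealIsIntegrallyClosed {A : Type*} [CommRing A] (I : Ideal A) : Prop :=
  ∀ x, IsIntegralOverIdeal I x → x ∈ I

/-- A Noetherian local ring is Cohen–Macaulay if some regular sequence contained in the
maximal ideal has length equal to the Krull dimension of the ring. -/
def IsCohenMacaulayLocalRing (R : Type*) [CommRing R] : Prop :=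
  IsNoetherianRing R ∧ ∃ h : IsLocalRing R,
    letI := h
    ∃ rs : List R, (∀ x ∈ rs, x ∈ IsLocalRing.maximalIdeal R) ∧
      RingTheory.Sequence.IsRegular R rs ∧ (rs.length : WithBot ℕ∞) = ringKrullDim R

/-- A Noetherian ring is Cohen–Macaulay if all its localizations at primes are
Cohen–Macaulay local rings. -/
def IsCohenMacaulayRing (R : Type*) [CommRing R] : Prop :=
  IsNoetherianRing R ∧ ∀ (P : Ideal R) (hP : P.IsPrime),
    letI := hP
    IsCohenMacaulayLocalRing (Localization.AtPrime P)

/-- A Cohen–Macaulay normal domain. -/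
def IsCMNormalDomain (R : Type*) [CommRing R] : Prop :=
  IsCohenMacaulayRing R ∧ IsDomain R ∧ IsIntegrallyClosed R

theorem exists_prime_eq_colon {R : Type*} [CommRing R] [IsNoetherianRing R] (K : Ideal R)
    {h x : R} (hx : x ∉ K) (hhx : h * x ∈ K) :
    ∃ P : Ideal R, P.IsPrime ∧ h ∈ P ∧ ∃ w, w ∉ K ∧ ∀ p, p ∈ P ↔ p * w ∈ K := by
  have hne : (Ideal.Quotient.mk K x) ≠ 0 := by
    rwa [Ne, Ideal.Quotient.eq_zero_iff_mem]
  obtain ⟨P, hP, hle⟩ := exists_le_isAssociatedPrime_of_isNoetherianRing R _ hne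
  rw [isAssociatedPrime_iff] at hP
  obtain ⟨hPp, y, hy⟩ := hP
  obtain ⟨w, rfl⟩ := Ideal.Quotient.mk_surjective y
  have key : ∀ p, p ∈ P ↔ p * w ∈ K := by
    intro p
    rw [hy, Submodule.mem_colon_singleton, Submodule.mem_bot, Algebra.smul_def,
      Ideal.Quotient.algebraMap_eq, ← map_mul, Ideal.Quotient.eq_zero_iff_mem]
  refine ⟨P, hPp, hle ?_, w, ?_, key⟩
  · rw [Submodule.mem_colon_singleton, Submodule.mem_bot, Algebra.smul_def,
      Ideal.Quotient.algebraMap_eq, ← map_mul, Ideal.Quotient.eq_zero_iff_mem]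
    exact hhx
  · intro hw
    exact hPp.ne_top ((Ideal.eq_top_iff_one _).2 ((key 1).2 (by simpa using hw)))

theorem exists_mem_forall_notMem_of_infinite (k : Type*) [Field k] [Infinite k] {A : Type*}
    [CommRing A] [Algebra k A] (I : Ideal A) {S : Set (Ideal A)} (hS : S.Finite)
    (h : ∀ W ∈ S, ¬ I ≤ W) : ∃ x ∈ I, ∀ W ∈ S, x ∉ W := by
  classical
  let V := I.restrictScalars k
  let f : Ideal A → Subspace k V := fun W => (W.restrictScalars k).comap V.subtype
  have ht : ⊤ ∉ (hS.toFinset.image f) := by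
    intro hmem
    obtain ⟨W, hW, hWt⟩ := Finset.mem_image.1 hmem
    refine h W (hS.mem_toFinset.1 hW) fun x hx => ?_
    have : (⟨x, hx⟩ : V) ∈ f W := hWt ▸ Submodule.mem_top
    exact this
  obtain ⟨x, hx⟩ := (Set.ne_univ_iff_exists_notMem _).1
    (Subspace.biUnion_ne_univ_of_top_notMem ht)
  refine ⟨x, x.2, fun W hW hxW => hx ?_⟩
  refine Set.mem_biUnion (Finset.mem_coe.2 (Finset.mem_image_of_mem f (hS.mem_toFinset.2 hW))) ?_
  exact hxW

theorem height_le_one_of_eq_colon {D : Type*} [CommRing D] [IsDomain D] [IsNoetherianRing D]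
    [IsIntegrallyClosed D] {x w : D} (hx : x ≠ 0) (hw : ¬ x ∣ w) (P : Ideal D) [hP : P.IsPrime]
    (h : ∀ p, p ∈ P ↔ x ∣ p * w) : P.height ≤ 1 := by
  have hxP : x ∈ P := (h x).2 (dvd_mul_right _ _)
  by_cases hc : ∀ p ∈ P, ∃ q ∈ P, p * w = x * q
  · exfalso
    have hx' : algebraMap D (FractionRing D) x ≠ 0 := by
      simpa using hx
    have hint : IsIntegral D
        (algebraMap D (FractionRing D) w / algebraMap D (FractionRing D) x) := by
      refine isIntegral_of_smul_mem_submodule (A := FractionRing D) (M := FractionRing D)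
        (Submodule.map (Algebra.linearMap D (FractionRing D)) P) ?_ ?_ _ ?_
      · intro hb
        have : algebraMap D (FractionRing D) x ∈
            Submodule.map (Algebra.linearMap D (FractionRing D)) P :=
          ⟨x, hxP, rfl⟩
        rw [hb, Submodule.mem_bot] at this
        exact hx' this
      · exact Submodule.FG.map _ (IsNoetherian.noetherian P)
      · rintro _ ⟨p, hp, rfl⟩
        obtain ⟨q, hq, e⟩ := hc p hp
        refine ⟨q, hq, ?_⟩
        have e' := congrArg (algebraMap D (FractionRing D)) e
        rw [map_mul, map_mul] at e'
        simp only [Algebra.linearMap_apply, smul_eq_mul]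
        field_simp
        linear_combination -e'
    obtain ⟨d, hd⟩ := IsIntegrallyClosed.isIntegral_iff.1 hint
    refine hw ⟨d, ?_⟩
    apply FaithfulSMul.algebraMap_injective D (FractionRing D)
    rw [map_mul, hd, mul_div_cancel₀ _ hx']
  · push Not at hc
    obtain ⟨p, hp, hc⟩ := hc
    obtain ⟨p', e⟩ := (h p).1 hp
    have hp' : p' ∉ P := fun hh => hc p' hh e
    refine Ideal.height_le_one_of_isPrincipal_of_mem_minimalPrimes (Ideal.span {p}) P
      ⟨⟨hP, by simpa [Ideal.span_le] using hp⟩, ?_⟩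
    rintro q ⟨hq, hpq⟩ hqP r hr
    obtain ⟨r', e'⟩ := (h r).1 hr
    have e2 : r * p' = r' * p := by
      apply mul_left_cancel₀ hx
      linear_combination p * e' - r * e
    have : r * p' ∈ q := e2 ▸ q.mul_mem_left _ (hpq (Ideal.mem_span_singleton_self p))
    exact (hq.mem_or_mem this).resolve_right fun hh => hp' (hqP hh)

theorem dvd_of_dvd_mul_of_forall_height_le_one {D : Type*} [CommRing D] [IsDomain D]
    [IsNoetherianRing D] [IsIntegrallyClosed D] {x y : D} (hx : x ≠ 0)
    (h : ∀ P : Ideal D, P.IsPrime → x ∈ P → P.height ≤ 1 → y ∉ P) {u : D} (hu : x ∣ y * u) :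
    x ∣ u := by
  by_contra hc
  obtain ⟨P, hP, hyP, w, hw, hPw⟩ := exists_prime_eq_colon (Ideal.span {x})
    (h := y) (x := u) (by rwa [Ideal.mem_span_singleton]) (by rwa [Ideal.mem_span_singleton])
  simp only [Ideal.mem_span_singleton] at hw hPw
  exact h P hP ((hPw x).2 (dvd_mul_right _ _)) (height_le_one_of_eq_colon hx hw P hPw) hyP

theorem exists_notMem_dvd_or_dvd {D : Type*} [CommRing D] [IsDomain D]
    [IsNoetherianRing D] [IsIntegrallyClosed D] (Q : Ideal D) [Q.IsPrime] (hQ : Q ≠ ⊥)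
    (hh : Q.height ≤ 1) (u v : D) : ∃ g, g ∉ Q ∧ (u ∣ g * v ∨ v ∣ g * u) := by
  have hS : Q.primeCompl ≤ nonZeroDivisors D := Q.primeCompl_le_nonZeroDivisors
  let L := Localization.AtPrime Q
  have : IsDomain L := IsLocalization.isDomain_localization hS
  have : IsIntegrallyClosed L := isIntegrallyClosed_of_isLocalization L _ hS
  have : IsNoetherianRing L := IsLocalization.isNoetherianRing Q.primeCompl L inferInstance
  have hinj : Function.Injective (algebraMap D L) := IsLocalization.injective L hS
  have hf : ¬ IsField L := by
    rw [IsLocalRing.isField_iff_maximalIdeal_eq]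
    intro hb
    refine hQ ((Submodule.eq_bot_iff _).2 fun x hx => ?_)
    have : algebraMap D L x ∈ IsLocalRing.maximalIdeal L :=
      (IsLocalization.AtPrime.to_map_mem_maximal_iff L Q x).2 hx
    rw [hb, Ideal.mem_bot] at this
    exact hinj (by simpa using this)
  have hd : Ring.KrullDimLE 1 L := by
    rw [Ring.krullDimLE_iff, IsLocalization.AtPrime.ringKrullDim_eq_height Q L]
    exact_mod_cast hh
  have hv : ValuationRing L := by
    have h4 : IsIntegrallyClosed L ∧ ∃! P : Ideal L, P ≠ ⊥ ∧ P.IsPrime :=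
      ⟨inferInstance, IsLocalRing.maximalIdeal L,
        ⟨IsLocalRing.isField_iff_maximalIdeal_eq.not.1 hf, inferInstance⟩,
        fun P hP => IsLocalRing.eq_maximalIdeal (hP.2.isMaximal_of_ne_bot hP.1)⟩
    exact ((IsDiscreteValuationRing.TFAE L hf).out 1 3).2 h4
  have key : ∀ u v : D, algebraMap D L u ∣ algebraMap D L v → ∃ g, g ∉ Q ∧ u ∣ g * v := by
    rintro u v ⟨r, hr⟩
    obtain ⟨⟨x, s⟩, rfl⟩ := IsLocalization.mk'_surjective Q.primeCompl r
    refine ⟨s, s.2, x, hinj ?_⟩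
    rw [map_mul, map_mul, hr]
    have := IsLocalization.mk'_spec' L x s
    linear_combination (algebraMap D L u) * this
  rcases ValuationRing.dvd_total (algebraMap D L u) (algebraMap D L v) with h | h
  · obtain ⟨g, hg, h⟩ := key _ _ h
    exact ⟨g, hg, Or.inl h⟩
  · obtain ⟨g, hg, h⟩ := key _ _ h
    exact ⟨g, hg, Or.inr h⟩

theorem exists_mem_dvd_mul_of_height_le_one {D : Type*} [CommRing D] [IsDomain D]
    [IsNoetherianRing D] [IsIntegrallyClosed D] (Q : Ideal D) [hQp : Q.IsPrime] (hQ : Q ≠ ⊥)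
    (hh : Q.height ≤ 1) {S : Set D} (hS : S.Finite) (hne : S.Nonempty) :
    ∃ c ∈ S, ∃ g, g ∉ Q ∧ ∀ j ∈ S, c ∣ g * j := by
  induction S, hS using Set.Finite.induction_on with
  | empty => simp at hne
  | @insert x S _ hS ih =>
    rcases S.eq_empty_or_nonempty with rfl | hne'
    · exact ⟨x, by simp, 1, fun h => hQp.ne_top ((Ideal.eq_top_iff_one _).2 h), by simp⟩
    obtain ⟨c, hc, g, hg, h⟩ := ih hne'
    obtain ⟨g', hg', h' | h'⟩ := exists_notMem_dvd_or_dvd Q hQ hh c x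
    · refine ⟨c, Or.inr hc, g * g', fun hm => (hQp.mem_or_mem hm).elim hg hg', ?_⟩
      rintro j (rfl | hj)
      · exact (h'.mul_left g).trans (dvd_of_eq (by ring))
      · exact ((h j hj).mul_left g').trans (dvd_of_eq (by ring))
    · refine ⟨x, Or.inl rfl, g * g', fun hm => (hQp.mem_or_mem hm).elim hg hg', ?_⟩
      rintro j (rfl | hj)
      · exact dvd_mul_left _ _
      · obtain ⟨e, he⟩ := h j hj
        obtain ⟨e', he'⟩ := h'
        exact ⟨e' * e, by linear_combination g' * he + e * he'⟩

theorem mem_span_pair_of_exchange {D : Type*} [CommRing D] {x y z : D} {K : Ideal D}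
    (hy : ∀ u, x ∣ y * u → x ∣ u) (hz : ∀ u, x ∣ z * u → x ∣ u)
    (h : ∀ w, (∀ m ∈ K, m * w ∈ Ideal.span {x, z}) → w ∈ Ideal.span {x, z}) (hzK : z ∈ K)
    {w : D} (hw : ∀ m ∈ K, m * w ∈ Ideal.span {x, y}) : w ∈ Ideal.span {x, y} := by
  obtain ⟨α, w', e⟩ := Ideal.mem_span_pair.1 (hw z hzK)
  have hw' : w' ∈ Ideal.span {x, z} := by
    refine h w' fun m hm => ?_
    obtain ⟨γ, β, e'⟩ := Ideal.mem_span_pair.1 (hw m hm)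
    obtain ⟨δ, hδ⟩ := hy (m * w' - β * z) ⟨z * γ - m * α, by linear_combination m * e - z * e'⟩
    exact Ideal.mem_span_pair.2 ⟨δ, β, by linear_combination -hδ⟩
  obtain ⟨γ, β, e'⟩ := Ideal.mem_span_pair.1 hw'
  obtain ⟨δ, hδ⟩ := hz (w - y * β) ⟨α + y * γ, by linear_combination - e - y * e'⟩
  exact Ideal.mem_span_pair.2 ⟨δ, β, by linear_combination -hδ⟩

theorem dvd_of_dvd_mul_swap {D : Type*} [CommRing D] [IsDomain D] {x y : D} (hx : x ≠ 0)
    (h : ∀ u, x ∣ y * u → x ∣ u) (u : D) (hu : y ∣ x * u) : y ∣ u := by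
  obtain ⟨v, hv⟩ := hu
  obtain ⟨w, rfl⟩ := h v ⟨u, hv.symm⟩
  exact ⟨w, mul_left_cancel₀ hx (by linear_combination hv)⟩

/-- Given elements `y`, `s` of the maximal ideal that are regular modulo `x` and `r` respectively,
some element of the maximal ideal is regular modulo both `x` and `r`. -/
theorem exists_mem_forall_dvd_of_dvd_mul {D : Type*} [CommRing D] [IsNoetherianRing D]
    [IsLocalRing D] {x y r s : D}
    (hy : y ∈ IsLocalRing.maximalIdeal D) (hs : s ∈ IsLocalRing.maximalIdeal D)
    (hxy : ∀ u, x ∣ y * u → x ∣ u) (hrs : ∀ u, r ∣ s * u → r ∣ u) :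
    ∃ z ∈ IsLocalRing.maximalIdeal D, (∀ u, x ∣ z * u → x ∣ u) ∧ (∀ u, r ∣ z * u → r ∣ u) := by
  classical
  have hfin : (associatedPrimes D (D ⧸ Ideal.span {x}) ∪
    associatedPrimes D (D ⧸ Ideal.span {r})).Finite :=
    (associatedPrimes.finite _ _).union (associatedPrimes.finite _ _)
  have hass : ∀ (x y : D), y ∈ IsLocalRing.maximalIdeal D → (∀ u, x ∣ y * u → x ∣ u) →
      ∀ P ∈ associatedPrimes D (D ⧸ Ideal.span {x}), ¬ IsLocalRing.maximalIdeal D ≤ P := by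
    intro x y hy hxy P hP hle
    obtain ⟨hPp, m, hm⟩ := isAssociatedPrime_iff.1 hP
    obtain ⟨w, rfl⟩ := Ideal.Quotient.mk_surjective m
    have key : ∀ p, p ∈ P ↔ x ∣ p * w := by
      intro p
      rw [hm, Submodule.mem_colon_singleton, Submodule.mem_bot, Algebra.smul_def,
        Ideal.Quotient.algebraMap_eq, ← map_mul, Ideal.Quotient.eq_zero_iff_mem,
        Ideal.mem_span_singleton]
    refine hPp.ne_top ((Ideal.eq_top_iff_one _).2 ((key 1).2 ?_))
    simpa using hxy _ ((key y).1 (hle hy))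
  have hex :
      ¬ ((IsLocalRing.maximalIdeal D : Set D) ⊆ ⋃ P ∈ (hfin.toFinset : Set (Ideal D)), P) := by
    have := Ideal.subset_union_prime (s := hfin.toFinset) (f := id) ⊥ ⊥
      (fun P hP _ _ => by
        rcases hfin.mem_toFinset.1 hP with h | h
        · exact h.1
        · exact h.1) (I := IsLocalRing.maximalIdeal D)
    intro hc
    obtain ⟨P, hP, hle⟩ := this.1 hc
    rcases hfin.mem_toFinset.1 hP with h | h
    · exact hass x y hy hxy P h hle
    · exact hass r s hs hrs P h hle
  obtain ⟨z, hz, hzn⟩ := Set.not_subset.1 hex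
  simp only [Set.mem_iUnion, not_exists] at hzn
  have fin : ∀ x : D, (∀ P ∈ associatedPrimes D (D ⧸ Ideal.span {x}), z ∉ P) →
      ∀ u, x ∣ z * u → x ∣ u := by
    intro x hx u hu
    by_contra hc
    have hmem : z ∈ ⋃ p ∈ associatedPrimes D (D ⧸ Ideal.span {x}), (p : Set D) := by
      rw [biUnion_associatedPrimes_eq_zero_divisors]
      refine ⟨Ideal.Quotient.mk _ u, ?_, ?_⟩
      · rwa [Ne, Ideal.Quotient.eq_zero_iff_mem, Ideal.mem_span_singleton]
      · rwa [Algebra.smul_def, Ideal.Quotient.algebraMap_eq, ← map_mul,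
          Ideal.Quotient.eq_zero_iff_mem, Ideal.mem_span_singleton]
    simp only [Set.mem_iUnion] at hmem
    obtain ⟨P, hP, hzP⟩ := hmem
    exact hx P hP hzP
  exact ⟨z, hz, fin x fun P hP => hzn P (by simp [hP]), fin r fun P hP => hzn P (by simp [hP])⟩

/-- In a local ring of depth at least three, the maximal ideal is not associated to a regular
sequence of length two. -/
theorem mem_span_pair_of_isWeaklyRegular {D : Type*} [CommRing D] [IsDomain D]
    [IsNoetherianRing D] [IsLocalRing D] {rs : List D}
    (hrs : ∀ r ∈ rs, r ∈ IsLocalRing.maximalIdeal D)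
    (hreg : RingTheory.Sequence.IsWeaklyRegular D rs) (hlen : 3 ≤ rs.length) {x y : D}
    (hx0 : x ≠ 0)
    (hy : y ∈ IsLocalRing.maximalIdeal D) (hxy : ∀ u, x ∣ y * u → x ∣ u) {w : D}
    (hw : ∀ m ∈ IsLocalRing.maximalIdeal D, m * w ∈ Ideal.span {x, y}) :
    w ∈ Ideal.span {x, y} := by
  obtain ⟨r, s, t, l, rfl⟩ : ∃ r s t l, rs = r :: s :: t :: l := by
    match rs, hlen with
    | r :: s :: t :: l, _ => exact ⟨r, s, t, l, rfl⟩
  have h := (RingTheory.Sequence.isWeaklyRegular_iff _ _).1 hreg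
  have key : ∀ (K : Ideal D) (q : D), IsSMulRegular (D ⧸ (K • ⊤ : Submodule D D)) q →
      ∀ u, q * u ∈ K → u ∈ K := by
    intro K q hq u hu
    have h1 : (Submodule.Quotient.mk u : D ⧸ (K • ⊤ : Submodule D D)) = 0 := by
      apply hq
      simp only [smul_zero]
      rw [← Submodule.Quotient.mk_smul, Submodule.Quotient.mk_eq_zero]
      simpa using hu
    rw [Submodule.Quotient.mk_eq_zero] at h1
    simpa using h1
  have h0 := key _ _ (h 0 (by simp))
  have h1 := key _ _ (h 1 (by simp))
  have h2 := key _ _ (h 2 (by simp))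
  simp only [List.take_zero, List.take_succ_cons, Ideal.ofList_nil, Ideal.ofList_cons,
    List.getElem_cons_zero, List.getElem_cons_succ, Ideal.mem_bot, sup_bot_eq,
    Ideal.mem_span_singleton] at h0 h1 h2
  have hr0 : r ≠ 0 := by
    rintro rfl
    exact one_ne_zero (h0 1 (by simp))
  obtain ⟨z, hz, hxz, hrz⟩ := exists_mem_forall_dvd_of_dvd_mul hy (hrs s (by simp)) hxy h1
  refine mem_span_pair_of_exchange hxy hxz (fun w hw => ?_) hz hw
  rw [Set.pair_comm] at hw ⊢
  have hz0 : z ≠ 0 := by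
    rintro rfl
    have := hrz 1 (by simp)
    exact (IsLocalRing.mem_maximalIdeal _).1 (hrs r (by simp)) (isUnit_of_dvd_one this)
  refine mem_span_pair_of_exchange (dvd_of_dvd_mul_swap hx0 hxz) (dvd_of_dvd_mul_swap hr0 hrz)
    (fun w hw => ?_) (hrs r (by simp)) hw
  rw [Set.pair_comm] at hw ⊢
  refine mem_span_pair_of_exchange hrz h1 (fun w hw => ?_) (hrs s (by simp)) hw
  rw [Ideal.span_insert] at hw ⊢
  exact h2 w (hw t (hrs t (by simp)))

theorem ringKrullDim_adjoin_insert_le {A T : Type*} [CommRing A] [IsNoetherianRing A] [CommRing T]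
    [IsDomain T] [Algebra A T] {s : Set T} (hs : s.Finite) {g r q : T}
    (hr : r ∈ Algebra.adjoin A s) (hr0 : r ≠ 0) (hq : q ∈ Algebra.adjoin A s) (h : r * g = q) :
    ringKrullDim (Algebra.adjoin A (insert g s)) + 1 ≤ ringKrullDim (Algebra.adjoin A s) + 1 := by
  have hB : IsNoetherianRing (Algebra.adjoin A s) := by
    have : Algebra.FiniteType A (Algebra.adjoin A s) :=
      (Algebra.adjoin A s).fg_iff_finiteType.1 (Subalgebra.fg_def.2 ⟨s, hs, rfl⟩)
    exact Algebra.FiniteType.isNoetherianRing A _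
  rw [← Polynomial.ringKrullDim_of_isNoetherianRing (R := Algebra.adjoin A s)]
  have e : Algebra.adjoin A (insert g s) =
      ((Polynomial.aeval g : Polynomial (Algebra.adjoin A s) →ₐ[Algebra.adjoin A s] T
        ).restrictScalars A).range := by
    rw [Set.insert_eq, Set.union_comm, Algebra.adjoin_union_eq_adjoin_adjoin,
      Algebra.adjoin_singleton_eq_range_aeval]
    rfl
  rw [e]
  let φ := ((Polynomial.aeval g : Polynomial (Algebra.adjoin A s) →ₐ[Algebra.adjoin A s] T
        ).restrictScalars A)
  refine ringKrullDim_succ_le_of_surjective (f := φ.rangeRestrict.toRingHom)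
    (hf := φ.rangeRestrict_surjective)
    (r := Polynomial.C ⟨r, hr⟩ * Polynomial.X - Polynomial.C ⟨q, hq⟩) ?_ ?_
  · rw [mem_nonZeroDivisors_iff_ne_zero]
    intro h0
    have := congrArg (fun p => Polynomial.coeff p 1) h0
    simp only [Polynomial.coeff_sub, Polynomial.coeff_C_mul, Polynomial.coeff_X_one, mul_one,
      Polynomial.coeff_C_succ, sub_zero, Polynomial.coeff_zero] at this
    exact hr0 (congrArg Subtype.val this)
  · apply Subtype.ext
    change Polynomial.aeval g _ = 0
    rw [map_sub, map_mul, Polynomial.aeval_C, Polynomial.aeval_X, Polynomial.aeval_C, sub_eq_zero]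
    exact h

open Polynomial in
theorem ringKrullDim_reesAlgebra_le {A : Type*} [CommRing A] [IsDomain A] [IsNoetherianRing A]
    {I : Ideal A} (hI : I ≠ ⊥) : ringKrullDim (reesAlgebra I) ≤ ringKrullDim A + 1 := by
  obtain ⟨f, hf, hf0⟩ := Submodule.exists_mem_ne_zero_of_ne_bot hI
  have key : ∀ s : Set A[X], s.Finite → (∀ g ∈ s, ∃ x, g = monomial 1 x) →
      ringKrullDim (Algebra.adjoin A (insert (monomial 1 f) s)) + 1 ≤ ringKrullDim A + 1 + 1 := by
    intro s hs
    induction s, hs using Set.Finite.induction_on with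
    | empty =>
      intro _
      gcongr
      rw [← ringKrullDim_of_isNoetherianRing, insert_empty_eq,
        Algebra.adjoin_singleton_eq_range_aeval]
      exact ringKrullDim_le_of_surjective
        (f := (aeval (R := A) (monomial 1 f : A[X])).rangeRestrict.toRingHom)
        (hf := (aeval (R := A) (monomial 1 f : A[X])).rangeRestrict_surjective)
    | @insert g s _ hs ih =>
      intro hg
      obtain ⟨x, rfl⟩ := hg g (by simp)
      refine le_trans ?_ (ih fun g hgs => hg g (Or.inr hgs))
      rw [Set.insert_comm]
      refine ringKrullDim_adjoin_insert_le (hs.insert _) (r := C f) (q := C x * monomial 1 f)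
        (Subalgebra.algebraMap_mem _ f) (by simpa using hf0)
        (Subalgebra.mul_mem _ (Subalgebra.algebraMap_mem _ x)
          (Algebra.subset_adjoin (Set.mem_insert _ _))) ?_
      rw [C_mul_monomial, C_mul_monomial, mul_comm]
  obtain ⟨s, hs⟩ := (IsNoetherian.noetherian I : I.FG)
  have hsI : (s : Set A) ⊆ I := hs ▸ Ideal.subset_span
  have e : Algebra.adjoin A (insert (monomial 1 f) ((monomial 1 : A →ₗ[A] A[X]) '' s)) =
      reesAlgebra I := by
    apply le_antisymm
    · refine Algebra.adjoin_le ?_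
      rintro _ (rfl | ⟨x, hx, rfl⟩)
      · exact reesAlgebra.monomial_mem.2 (by simpa using hf)
      · exact reesAlgebra.monomial_mem.2 (by simpa using hsI hx)
    · rw [← adjoin_monomial_eq_reesAlgebra]
      conv_lhs => rw [← hs]
      have : Submodule.map (monomial 1 : A →ₗ[A] A[X]) (Ideal.span (s : Set A)) =
        Submodule.span A ((monomial 1 : A →ₗ[A] A[X]) '' s) := Submodule.map_span _ _
      rw [this, Algebra.adjoin_span]
      exact Algebra.adjoin_mono (Set.subset_insert _ _)
  have h := key _ (s.finite_toSet.image _) (by rintro _ ⟨x, _, rfl⟩; exact ⟨x, rfl⟩)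
  rw [e] at h
  exact (WithBot.add_le_add_iff_right' (c := 1) WithBot.one_ne_bot (by decide)).1 h

theorem mem_of_span_singleton_mul_le {A : Type*} [CommRing A] [IsDomain A] [IsNoetherianRing A]
    {J K : Ideal A} (hJ : IdealIsIntegrallyClosed J) (hK : K ≠ ⊥) {s : A}
    (h : Ideal.span {s} * K ≤ J * K) : s ∈ J := by
  let f : Module.End A K := LinearMap.lsmul A K s
  have hf : LinearMap.range f ≤ J • (⊤ : Submodule A K) := by
    rw [← Submodule.map_le_map_iff_of_injective K.injective_subtype, Submodule.map_smul'',
      Submodule.map_top, Submodule.range_subtype]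
    rintro _ ⟨_, ⟨x, rfl⟩, rfl⟩
    exact h (Ideal.mul_mem_mul (Ideal.mem_span_singleton_self s) x.2)
  obtain ⟨p, hp, -, hpc, hp0⟩ :=
    LinearMap.exists_monic_and_natDegree_eq_and_coeff_mem_pow_and_aeval_eq_zero A f J hf
  obtain ⟨x, hx, hx0⟩ := Submodule.exists_mem_ne_zero_of_ne_bot hK
  have hroot : p.eval s = 0 := by
    have hx' : ((Polynomial.aeval f p) ⟨x, hx⟩ : A) = p.eval s * x := by
      have : f = algebraMap A (Module.End A K) s := rfl
      rw [this, Polynomial.aeval_algebraMap_apply]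
      rfl
    rw [hp0] at hx'
    exact (mul_eq_zero.1 hx'.symm).resolve_right hx0
  refine hJ s ⟨p.natDegree, ?_, fun i => p.coeff (p.natDegree - i), ?_, ?_⟩
  · rw [Nat.pos_iff_ne_zero]
    intro h0
    rw [hp.natDegree_eq_zero.1 h0] at hroot
    simp at hroot
  · intro i _ hi
    simpa [Nat.sub_sub_self hi] using hpc (p.natDegree - i)
  · rw [Polynomial.eval_eq_sum_range, Finset.sum_range_succ, hp.coeff_natDegree, one_mul,
      add_comm, ← Finset.sum_range_reflect] at hroot
    rw [← hroot, Finset.range_eq_Ico, ← Finset.Ico_add_one_right_eq_Icc,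
      ← zero_add (1 : ℕ), ← Finset.sum_Ico_add' _ 0 p.natDegree 1]
    simp [Nat.sub_sub, add_comm 1]

theorem exists_eq_add_of_mem_pow {A : Type*} [CommRing A] {I : Ideal A} {a a' : A}
    (h : ∀ x ∈ I ^ 2, ∃ y ∈ I, ∃ w ∈ I, x = a * y + a' * w) (n : ℕ) :
    I ^ (n + 2) ≤ Ideal.span {a} * I ^ (n + 1) ⊔ Ideal.span {a'} * I ^ (n + 1) := by
  have h2 : I ^ 2 ≤ Ideal.span {a} * I ⊔ Ideal.span {a'} * I := by
    intro x hx
    obtain ⟨y, hy, w, hw, rfl⟩ := h x hx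
    exact Submodule.add_mem_sup (Ideal.mul_mem_mul (Ideal.mem_span_singleton_self a) hy)
      (Ideal.mul_mem_mul (Ideal.mem_span_singleton_self a') hw)
  calc I ^ (n + 2) = I ^ n * I ^ 2 := pow_add _ _ _
    _ ≤ I ^ n * (Ideal.span {a} * I ⊔ Ideal.span {a'} * I) := Ideal.mul_mono_right h2
    _ = _ := by rw [Ideal.mul_sup]; congr 1 <;> ring

/-- Descending induction along the filtration `⋃ m, (J * I ^ (n + m) : I ^ m)`. -/
theorem mul_eq_span_mul_sup_of_pow {A : Type*} [CommRing A] [IsDomain A] [IsNoetherianRing A]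
    {I J : Ideal A} (hJ : IdealIsIntegrallyClosed J) {a a' b : A} (ha : a ∈ I) (ha0 : a ≠ 0)
    (hb : b ∈ J) (h1 : ∀ x ∈ I ^ 2, ∃ y ∈ I, ∃ w ∈ I, x = a * y + a' * w) (ha' : a' ∈ I)
    (h2 : ∀ u, a ∣ a' * u → a ∣ u) (N : ℕ)
    (h3 : ∀ z ∈ I ^ (N + 1) * J, ∃ s ∈ I ^ N * J, ∃ w ∈ I ^ (N + 1), z = a * s + b * w) :
    I * J = Ideal.span {a} * J ⊔ Ideal.span {b} * I := by
  have key : ∀ n ≤ N, ∀ z ∈ I ^ (n + 1) * J, ∃ s, (∃ m, Ideal.span {s} * I ^ m ≤ J * I ^ (n + m)) ∧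
      ∃ w ∈ I ^ (n + 1), z = a * s + b * w := by
    intro n hn
    induction hn using Nat.decreasingInduction with
    | self =>
      intro z hz
      obtain ⟨s, hs, w, hw, e⟩ := h3 z hz
      refine ⟨s, ⟨0, ?_⟩, w, hw, e⟩
      rw [pow_zero, mul_one, add_zero, mul_comm J, Ideal.span_singleton_le_iff_mem]
      exact hs
    | of_succ n _ ih =>
      intro z hz
      obtain ⟨x, ⟨m, hm⟩, v, hv, e⟩ := ih (a' * z) <| by
        rw [pow_succ' I (n + 1), mul_assoc]
        exact Ideal.mul_mem_mul ha' hz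
      obtain ⟨_, hy₀, _, hw₀, rfl⟩ := Submodule.mem_sup.1 (exists_eq_add_of_mem_pow h1 n hv)
      obtain ⟨y, hy, rfl⟩ := Ideal.mem_span_singleton_mul.1 hy₀
      obtain ⟨w, hw, rfl⟩ := Ideal.mem_span_singleton_mul.1 hw₀
      obtain ⟨s, hs⟩ := h2 (z - b * w) ⟨x + b * y, by linear_combination e⟩
      have hs' : a' * s = x + b * y := mul_left_cancel₀ ha0 (by linear_combination e - a' * hs)
      refine ⟨s, ⟨m + 2, ?_⟩, w, hw, by linear_combination hs⟩
      have e1 : Ideal.span {a} * (Ideal.span {s} * I ^ m) ≤ J * I ^ (n + 1 + m) := by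
        rw [← mul_assoc, Ideal.span_singleton_mul_span_singleton, pow_add, ← mul_assoc, ← hs]
        refine Ideal.mul_mono_left ((Ideal.span_singleton_le_iff_mem _).2 (sub_mem ?_ ?_))
        · rwa [mul_comm]
        · exact Ideal.mul_mem_mul hb hw
      have e2 : Ideal.span {a'} * (Ideal.span {s} * I ^ m) ≤ J * I ^ (n + 1 + m) := by
        rw [← mul_assoc, Ideal.span_singleton_mul_span_singleton, hs',
          Ideal.span_singleton_mul_le_iff]
        intro q hq
        rw [add_mul]
        refine add_mem (hm (Ideal.mul_mem_mul (Ideal.mem_span_singleton_self x) hq)) ?_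
        rw [mul_assoc, pow_add]
        exact Ideal.mul_mem_mul hb (Ideal.mul_mem_mul hy hq)
      calc Ideal.span {s} * I ^ (m + 2)
          ≤ Ideal.span {s} * (Ideal.span {a} * I ^ (m + 1) ⊔ Ideal.span {a'} * I ^ (m + 1)) :=
            Ideal.mul_mono_right (exists_eq_add_of_mem_pow h1 m)
        _ = (Ideal.span {a} * (Ideal.span {s} * I ^ m) ⊔
            Ideal.span {a'} * (Ideal.span {s} * I ^ m)) * I := by
            rw [Ideal.mul_sup, Ideal.sup_mul]; congr 1 <;> ring
        _ ≤ J * I ^ (n + 1 + m) * I := Ideal.mul_mono_left (sup_le e1 e2)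
        _ = J * I ^ (n + (m + 2)) := by ring
  refine le_antisymm (fun z hz => ?_) (sup_le ?_ ?_)
  · obtain ⟨s, ⟨m, hm⟩, w, hw, rfl⟩ := key 0 (Nat.zero_le _) z (by simpa using hz)
    rw [zero_add] at hm
    have hI : I ^ m ≠ ⊥ := pow_ne_zero m (Submodule.ne_bot_iff _ |>.2 ⟨a, ha, ha0⟩)
    exact Submodule.add_mem_sup
      (Ideal.mul_mem_mul (Ideal.mem_span_singleton_self a) (mem_of_span_singleton_mul_le hJ hI hm))
      (Ideal.mul_mem_mul (Ideal.mem_span_singleton_self b) (by simpa using hw))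
  · exact Ideal.mul_mono_left ((Ideal.span_singleton_le_iff_mem _).2 ha)
  · rw [mul_comm I]
    exact Ideal.mul_mono_left ((Ideal.span_singleton_le_iff_mem _).2 hb)

theorem not_height_le_one_of_lt {R : Type*} [CommRing R] [IsDomain R] {Q P : Ideal R} [Q.IsPrime]
    [P.IsPrime] (hQ : Q ≠ ⊥) (h : Q < P) : ¬ P.height ≤ 1 := by
  intro hP
  have h1 := Ideal.height_add_one_le_of_lt_of_isPrime (bot_lt_iff_ne_bot.2 hQ)
  have h2 := Ideal.height_add_one_le_of_lt_of_isPrime h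
  have h3 : (1 + 1 : ℕ∞) ≤ 1 :=
    le_trans (add_le_add_left (le_trans le_add_self h1) 1) (h2.trans hP)
  exact absurd h3 (by decide)

theorem three_le_height_of_lt_of_lt {R : Type*} [CommRing R] [IsDomain R] {Q P P' : Ideal R}
    [Q.IsPrime] [P.IsPrime] [P'.IsPrime] (hQ : Q ≠ ⊥) (h : Q < P) (h' : P < P') :
    3 ≤ P'.height := by
  have h1 := Ideal.height_add_one_le_of_lt_of_isPrime (bot_lt_iff_ne_bot.2 hQ)
  have h2 := Ideal.height_add_one_le_of_lt_of_isPrime h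
  have h3 := Ideal.height_add_one_le_of_lt_of_isPrime h'
  calc (3 : ℕ∞) = 0 + 1 + 1 + 1 := by norm_num
    _ ≤ (⊥ : Ideal R).height + 1 + 1 + 1 := by gcongr; exact zero_le
    _ ≤ Q.height + 1 + 1 := by gcongr
    _ ≤ P.height + 1 := by gcongr
    _ ≤ _ := h3

theorem not_chain_of_ringKrullDim_le_three {R : Type*} [CommRing R] [IsDomain R]
    (hdim : ringKrullDim R ≤ 3) {Q P P' M : Ideal R} [Q.IsPrime] [P.IsPrime] [P'.IsPrime]
    [M.IsPrime] (hQ : Q ≠ ⊥) (h : Q < P) (h' : P < P') : ¬ P' < M := by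
  intro hM
  have h1 := three_le_height_of_lt_of_lt hQ h h'
  have h2 := Ideal.height_add_one_le_of_lt_of_isPrime hM
  have h3 : ((3 + 1 : ℕ∞) : WithBot ℕ∞) ≤ ((3 : ℕ∞) : WithBot ℕ∞) :=
    le_trans (WithBot.coe_le_coe.2 ((add_le_add_left h1 1).trans h2))
      (Ideal.height_le_ringKrullDim_of_isPrime.trans hdim)
  exact absurd (WithBot.coe_le_coe.1 h3) (by decide)

theorem mem_minimalPrimes_span_singleton_of_height_le_one {R : Type*} [CommRing R] [IsDomain R]
    {P : Ideal R} [hP : P.IsPrime] (h : P.height ≤ 1) {x : R} (hx : x ≠ 0) (hxP : x ∈ P) :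
    P ∈ (Ideal.span {x}).minimalPrimes := by
  refine ⟨⟨hP, (Ideal.span_singleton_le_iff_mem _).2 hxP⟩, fun q hq hqP => ?_⟩
  have := hq.1
  by_contra hc
  refine not_height_le_one_of_lt (Q := q) (P := P) ?_ (lt_of_le_not_ge hqP hc) h
  exact (Submodule.ne_bot_iff _).2 ⟨x, (Ideal.span_singleton_le_iff_mem _).1 hq.2, hx⟩

theorem two_le_height_maximalIdeal {A : Type*} [CommRing A] [IsLocalRing A]
    (hdim : ringKrullDim A = 2) : ¬ (IsLocalRing.maximalIdeal A).height ≤ 1 := by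
  intro h
  have h1 := IsLocalRing.maximalIdeal_height_eq_ringKrullDim (R := A)
  rw [hdim] at h1
  have h2 : (IsLocalRing.maximalIdeal A).height = 2 := WithBot.coe_injective h1
  rw [h2] at h
  exact absurd h (by decide)

/-- In dimension two, a prime containing `a ≠ 0` and an element outside all the minimal primes
of `a` is maximal. -/
theorem eq_maximalIdeal_of_mem_of_mem {A : Type*} [CommRing A] [IsDomain A] [IsLocalRing A]
    (hdim : ringKrullDim A = 2) {a y : A} (ha : a ≠ 0)
    (hy : ∀ q ∈ (Ideal.span {a}).minimalPrimes, y ∉ q) {p : Ideal A} [hp : p.IsPrime]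
    (hap : a ∈ p) (hyp : y ∈ p) : p = IsLocalRing.maximalIdeal A := by
  by_contra hne
  have hlt : p < IsLocalRing.maximalIdeal A :=
    lt_of_le_of_ne (IsLocalRing.le_maximalIdeal hp.ne_top) hne
  obtain ⟨q, hq, hqp⟩ := Ideal.exists_minimalPrimes_le
    ((Ideal.span_singleton_le_iff_mem p).2 hap)
  have := hq.1.1
  have hq0 : q ≠ ⊥ := (Submodule.ne_bot_iff _).2
    ⟨a, (Ideal.span_singleton_le_iff_mem _).1 hq.1.2, ha⟩
  have h3 := three_le_height_of_lt_of_lt hq0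
    (lt_of_le_of_ne hqp fun h => hy q hq (h ▸ hyp)) hlt
  have h1 := IsLocalRing.maximalIdeal_height_eq_ringKrullDim (R := A)
  rw [hdim] at h1
  have h2 : (IsLocalRing.maximalIdeal A).height = 2 := WithBot.coe_injective h1
  rw [h2] at h3
  exact absurd h3 (by decide)

theorem not_le_of_mem_minimalPrimes_span_singleton {A : Type*} [CommRing A] [IsNoetherianRing A]
    [IsLocalRing A] (hdim : ringKrullDim A = 2) {a : A} {J : Ideal A}
    (hJ : ∃ n : ℕ, IsLocalRing.maximalIdeal A ^ n ≤ J) {p : Ideal A}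
    (hp : p ∈ (Ideal.span {a}).minimalPrimes) : ¬ J ≤ p := by
  intro h
  obtain ⟨n, hn⟩ := hJ
  have := hp.1.1
  exact two_le_height_maximalIdeal hdim
    ((Ideal.height_mono (Ideal.IsPrime.le_of_pow_le (hn.trans h))).trans
      (Ideal.height_le_one_of_isPrincipal_of_mem_minimalPrimes _ p hp))

theorem map_maximalIdeal_le_of_forall_mem {A R : Type*} [CommRing A] [IsLocalRing A] [CommRing R]
    [Algebra A R] {J : Ideal A} (hJ : ∃ n : ℕ, IsLocalRing.maximalIdeal A ^ n ≤ J)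
    {P : Ideal R} [hP : P.IsPrime] (h : ∀ x ∈ J, algebraMap A R x ∈ P) :
    (IsLocalRing.maximalIdeal A).map (algebraMap A R) ≤ P := by
  obtain ⟨n, hn⟩ := hJ
  exact Ideal.map_le_iff_le_comap.2 (Ideal.IsPrime.le_of_pow_le (hn.trans h))

/-- Prime avoidance for elements `x` of `I` and their images under a linear map. -/
theorem exists_forall_notMem_and_forall_notMem (k : Type*) [Field k] [Infinite k] {A R : Type*}
    [CommRing A] [Algebra k A] [CommRing R] [Algebra A R] {I : Ideal A} (τ : I →ₗ[A] R)
    {S : Set (Ideal R)} (hS : S.Finite) {S' : Set (Ideal A)} (hS' : S'.Finite)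
    (h' : ∀ p ∈ S', ¬ I ≤ p) :
    ∃ a : I, (∀ P ∈ S, ¬ Ideal.span (Set.range τ) ≤ P → τ a ∉ P) ∧ ∀ p ∈ S', (a : A) ∉ p := by
  let W : Ideal R → Ideal A := fun P => ((P.restrictScalars A).comap τ).map I.subtype
  obtain ⟨x, hx, hxW⟩ := exists_mem_forall_notMem_of_infinite k I
    (((hS.subset (Set.sep_subset S fun P => ¬ Ideal.span (Set.range τ) ≤ P)).image W).union
      hS') <| by
      rintro _ (⟨P, ⟨_, hP⟩, rfl⟩ | hp) hle
      · refine hP (Ideal.span_le.2 ?_)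
        rintro _ ⟨y, rfl⟩
        obtain ⟨z, hz, hzy⟩ := hle y.2
        rw [Subtype.ext hzy] at hz
        exact hz
      · exact h' _ hp hle
  exact ⟨⟨x, hx⟩, fun P hP hPT hτ => hxW (W P) (Or.inl ⟨P, ⟨hP, hPT⟩, rfl⟩) ⟨⟨x, hx⟩, hτ, rfl⟩,
    fun p hp => hxW p (Or.inr hp)⟩

theorem height_le_one_of_mem_minimalPrimes_map {A R : Type*} [CommRing A] [IsLocalRing A]
    [CommRing R] [IsNoetherianRing R] [Algebra A R] {I : Ideal A}
    (hI : ∃ n : ℕ, IsLocalRing.maximalIdeal A ^ n ≤ I) (τ : I →ₗ[A] R) {a : I} {Q : Ideal R}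
    (hQ : Q ∈ ((IsLocalRing.maximalIdeal A).map (algebraMap A R)).minimalPrimes)
    (haQ : algebraMap A R a ∈ Q) (hτ : τ a ∉ Q) : Q.height ≤ 1 := by
  have := hQ.1.1
  refine Ideal.height_le_one_of_isPrincipal_of_mem_minimalPrimes
    (Ideal.span {algebraMap A R a}) Q
    ⟨⟨hQ.1.1, (Ideal.span_singleton_le_iff_mem _).2 haQ⟩, fun q hq hqQ => ?_⟩
  have := hq.1
  refine hQ.2 ⟨hq.1, map_maximalIdeal_le_of_forall_mem hI fun x hx => ?_⟩ hqQ
  have e : algebraMap A R x * τ a = τ ⟨x, hx⟩ * algebraMap A R a := by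
    rw [mul_comm (τ _), ← Algebra.smul_def, ← Algebra.smul_def, ← map_smul, ← map_smul]
    exact congrArg τ (Subtype.ext (mul_comm _ _))
  refine (hq.1.mem_or_mem (e ▸ Ideal.mul_mem_left _ _ ?_)).resolve_right fun h => hτ (hqQ h)
  exact (Ideal.span_singleton_le_iff_mem _).1 hq.2

section

variable {A R : Type*} [CommRing A] [IsLocalRing A] [CommRing R] [IsDomain R]
  [Algebra A R] {I : Ideal A} {τ : I →ₗ[A] R} {M : Ideal R} [M.IsPrime]

theorem span_range_le_of_mem_of_mem (hdim : ringKrullDim R ≤ 3)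
    (hm : (IsLocalRing.maximalIdeal A).map (algebraMap A R) ≠ ⊥)
    (hT : Ideal.span (Set.range τ) ≤ M) {a a' : I}
    (ha : ∀ P ∈ ((IsLocalRing.maximalIdeal A).map (algebraMap A R)).minimalPrimes,
      ¬ Ideal.span (Set.range τ) ≤ P → τ a ∉ P)
    (ha' : ∀ P ∈ ((IsLocalRing.maximalIdeal A).map (algebraMap A R) ⊔
      Ideal.span {τ a}).minimalPrimes, ¬ Ideal.span (Set.range τ) ≤ P → τ a' ∉ P)
    {P : Ideal R} [P.IsPrime] (hPM : P ≤ M)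
    (hmP : (IsLocalRing.maximalIdeal A).map (algebraMap A R) ≤ P) (haP : τ a ∈ P)
    (haP' : τ a' ∈ P) : Ideal.span (Set.range τ) ≤ P := by
  by_contra hTP
  obtain ⟨Q₁, hQ₁, hQ₁P⟩ := Ideal.exists_minimalPrimes_le
    (sup_le hmP ((Ideal.span_singleton_le_iff_mem _).2 haP))
  have := hQ₁.1.1
  obtain ⟨Q, hQ, hQQ₁⟩ := Ideal.exists_minimalPrimes_le (le_sup_left.trans hQ₁.1.2)
  have := hQ.1.1
  have hTQ₁ : ¬ Ideal.span (Set.range τ) ≤ Q₁ := fun h => hTP (h.trans hQ₁P)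
  refine not_chain_of_ringKrullDim_le_three hdim (Q := Q) (P := Q₁) (P' := P) (M := M)
    (fun h => hm (le_bot_iff.1 (h ▸ hQ.1.2))) (lt_of_le_of_ne hQQ₁ ?_) (lt_of_le_of_ne hQ₁P ?_)
    (lt_of_le_of_ne hPM ?_)
  · rintro rfl
    exact ha _ hQ hTQ₁ (hQ₁.1.2 (Ideal.mem_sup_right (Ideal.mem_span_singleton_self _)))
  · rintro rfl
    exact ha' _ hQ₁ hTQ₁ haP'
  · rintro rfl
    exact hTP hT

theorem not_iSup_colon_le [IsNoetherianRing A] [IsNoetherianRing R] [IsIntegrallyClosed R]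
    (hdim : ringKrullDim R ≤ 3)
    (hm : (IsLocalRing.maximalIdeal A).map (algebraMap A R) ≠ ⊥)
    (hT : Ideal.span (Set.range τ) ≤ M) (hI : ∃ n : ℕ, IsLocalRing.maximalIdeal A ^ n ≤ I)
    (hI' : I ≤ IsLocalRing.maximalIdeal A) {J : Ideal A}
    (hJ : ∃ n : ℕ, IsLocalRing.maximalIdeal A ^ n ≤ J) {a : I}
    (ha : ∀ P ∈ ((IsLocalRing.maximalIdeal A).map (algebraMap A R)).minimalPrimes,
      ¬ Ideal.span (Set.range τ) ≤ P → τ a ∉ P)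
    (ha' : ∀ P ∈ (⨆ c ∈ J, (Ideal.span {algebraMap A R c}).colon
      (algebraMap A R '' J)).minimalPrimes, ¬ Ideal.span (Set.range τ) ≤ P → τ a ∉ P)
    {Q₁ : Ideal R} (hQ₁ : Q₁ ∈ ((IsLocalRing.maximalIdeal A).map (algebraMap A R) ⊔
      Ideal.span {τ a}).minimalPrimes)
    (hTQ₁ : ¬ Ideal.span (Set.range τ) ≤ Q₁) (hQ₁M : Q₁ ≤ M) :
    ¬ ⨆ c ∈ J, (Ideal.span {algebraMap A R c}).colon (algebraMap A R '' J) ≤ Q₁ := by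
  intro hle
  have := hQ₁.1.1
  obtain ⟨P, hP, hPQ₁⟩ := Ideal.exists_minimalPrimes_le hle
  have := hP.1.1
  have hTP : ¬ Ideal.span (Set.range τ) ≤ P := fun h => hTQ₁ (h.trans hPQ₁)
  have hcP : ∀ c ∈ J, (Ideal.span {algebraMap A R c}).colon (algebraMap A R '' J) ≤ P :=
    fun c hc => (le_iSup₂_of_le c hc le_rfl).trans hP.1.2
  have hmP : (IsLocalRing.maximalIdeal A).map (algebraMap A R) ≤ P := by
    refine map_maximalIdeal_le_of_forall_mem hJ fun c hc => hcP c hc ?_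
    exact Submodule.mem_colon.2 fun s _ =>
      Ideal.mem_span_singleton.2 (by simp [smul_eq_mul])
  obtain ⟨Q, hQ, hQP⟩ := Ideal.exists_minimalPrimes_le hmP
  have := hQ.1.1
  have hτQ : τ a ∉ Q := ha Q hQ fun h => hTP (h.trans hQP)
  have hQ0 : Q ≠ ⊥ := fun h => hm (le_bot_iff.1 (h ▸ hQ.1.2))
  have hQh : Q.height ≤ 1 := height_le_one_of_mem_minimalPrimes_map hI τ hQ
    (hQ.1.2 (Ideal.mem_map_of_mem _ (hI' a.2))) hτQ
  refine not_chain_of_ringKrullDim_le_three hdim (Q := Q) (P := P) (P' := Q₁) (M := M)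
    hQ0 (lt_of_le_of_ne hQP ?_) (lt_of_le_of_ne hPQ₁ ?_) (lt_of_le_of_ne hQ₁M ?_)
  · obtain ⟨s, hs⟩ := (IsNoetherian.noetherian J : J.FG)
    obtain ⟨_, ⟨c, hc, rfl⟩, g, hg, hgs⟩ := exists_mem_dvd_mul_of_height_le_one Q hQ0 hQh
      ((s.finite_toSet.insert 0).image (algebraMap A R)) ((Set.insert_nonempty _ _).image _)
    have hcJ : c ∈ J := by
      rcases hc with rfl | hc
      · exact J.zero_mem
      · exact hs ▸ Ideal.subset_span hc
    rintro rfl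
    refine hg (hcP c hcJ (Submodule.mem_colon.2 ?_))
    rintro _ ⟨j, hj, rfl⟩
    have hle : J ≤ ((Ideal.span {algebraMap A R c}).colon {g}).comap (algebraMap A R) := by
      rw [← hs]
      refine Ideal.span_le.2 fun j hj => Submodule.mem_colon_singleton.2 ?_
      rw [smul_eq_mul, mul_comm]
      exact Ideal.mem_span_singleton.2 (hgs _ ⟨j, Or.inr hj, rfl⟩)
    have := Submodule.mem_colon_singleton.1 (hle hj)
    rwa [smul_eq_mul, mul_comm] at this
  · rintro rfl
    exact ha' _ hP hTP (hQ₁.1.2 (Ideal.mem_sup_right (Ideal.mem_span_singleton_self _)))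
  · rintro rfl
    exact hTQ₁ hT


theorem span_range_le_of_colon_le [IsDomain A] (hdimA : ringKrullDim A = 2)
    (hdim : ringKrullDim R ≤ 3)
    (hm : (IsLocalRing.maximalIdeal A).map (algebraMap A R) ≠ ⊥)
    (hT : Ideal.span (Set.range τ) ≤ M) {J : Ideal A} {a : I} {b : A} (ha0 : (a : A) ≠ 0)
    (ha : ∀ P ∈ ((IsLocalRing.maximalIdeal A).map (algebraMap A R)).minimalPrimes,
      ¬ Ideal.span (Set.range τ) ≤ P → τ a ∉ P)
    (hb : ∀ q ∈ (Ideal.span {(a : A)}).minimalPrimes, b ∉ q)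
    (hb' : ∀ P ∈ ((IsLocalRing.maximalIdeal A).map (algebraMap A R) ⊔
      Ideal.span {τ a}).minimalPrimes, ¬ Ideal.span (Set.range τ) ≤ P → P ≤ M →
      ¬ (Ideal.span {algebraMap A R b}).colon (algebraMap A R '' J) ≤ P)
    {P : Ideal R} [hP : P.IsPrime] (hPM : P ≤ M) (haP : τ a ∈ P)
    (hbP : (Ideal.span {algebraMap A R b}).colon (algebraMap A R '' J) ≤ P) :
    Ideal.span (Set.range τ) ≤ P := by
  by_contra hTP
  have haP' : algebraMap A R a ∈ P := by
    by_contra haP'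
    refine hTP (Ideal.span_le.2 ?_)
    rintro _ ⟨x, rfl⟩
    refine (hP.mem_or_mem (x := algebraMap A R a) ?_).resolve_left haP'
    have e : algebraMap A R a * τ x = algebraMap A R x * τ a := by
      rw [← Algebra.smul_def, ← Algebra.smul_def, ← map_smul, ← map_smul]
      exact congrArg τ (Subtype.ext (mul_comm _ _))
    rw [e]
    exact Ideal.mul_mem_left _ _ haP
  have hbP' : algebraMap A R b ∈ P := hbP <| Submodule.mem_colon.2 fun s _ =>
    Ideal.mem_span_singleton.2 (by simp [smul_eq_mul])
  have hmP : (IsLocalRing.maximalIdeal A).map (algebraMap A R) ≤ P := by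
    rw [Ideal.map_le_iff_le_comap]
    exact (eq_maximalIdeal_of_mem_of_mem hdimA ha0 hb (p := P.comap (algebraMap A R))
      haP' hbP').ge
  obtain ⟨Q₁, hQ₁, hQ₁P⟩ := Ideal.exists_minimalPrimes_le
    (sup_le hmP ((Ideal.span_singleton_le_iff_mem _).2 haP))
  have := hQ₁.1.1
  obtain ⟨Q, hQ, hQQ₁⟩ := Ideal.exists_minimalPrimes_le (le_sup_left.trans hQ₁.1.2)
  have := hQ.1.1
  have hTQ₁ : ¬ Ideal.span (Set.range τ) ≤ Q₁ := fun h => hTP (h.trans hQ₁P)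
  refine not_chain_of_ringKrullDim_le_three hdim (Q := Q) (P := Q₁) (P' := P) (M := M)
    (fun h => hm (le_bot_iff.1 (h ▸ hQ.1.2))) (lt_of_le_of_ne hQQ₁ ?_) (lt_of_le_of_ne hQ₁P ?_)
    (lt_of_le_of_ne hPM ?_)
  · rintro rfl
    exact ha _ hQ hTQ₁ (hQ₁.1.2 (Ideal.mem_sup_right (Ideal.mem_span_singleton_self _)))
  · rintro rfl
    exact hb' _ hQ₁ hTQ₁ hPM hbP
  · rintro rfl
    exact hTP hT

end

/-- The elements `b` of `J` with `(b : J)` not contained in `P` are generic in `J`. -/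
theorem exists_ideal_not_le_and_not_colon_le {A R : Type*} [CommRing A] [CommRing R] [IsDomain R]
    [Algebra A R] (hinj : Function.Injective (algebraMap A R)) {J : Ideal A} (hJ : J ≠ ⊥)
    (P : Ideal R) [hP : P.IsPrime]
    (h : ¬ ⨆ c ∈ J, (Ideal.span {algebraMap A R c}).colon (algebraMap A R '' J) ≤ P) :
    ∃ W : Ideal A, ¬ J ≤ W ∧ ∀ b ∈ J, b ∉ W →
      ¬ (Ideal.span {algebraMap A R b}).colon (algebraMap A R '' J) ≤ P := by
  simp only [iSup_le_iff, not_forall] at h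
  obtain ⟨c, hc, hcP⟩ := h
  obtain ⟨f, hf, hfP⟩ := Set.not_subset.1 hcP
  have hf' : ∀ j ∈ J, algebraMap A R c ∣ f * algebraMap A R j := fun j hj =>
    Ideal.mem_span_singleton.1 (Submodule.mem_colon.1 hf _ ⟨j, hj, rfl⟩)
  have hc0 : algebraMap A R c ≠ 0 := by
    intro hc0
    obtain ⟨j, hj, hj0⟩ := Submodule.exists_mem_ne_zero_of_ne_bot hJ
    have h0 := hf' j hj
    rw [hc0, zero_dvd_iff] at h0
    rcases mul_eq_zero.1 h0 with h0 | h0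
    · exact hfP (h0 ▸ P.zero_mem)
    · exact hj0 (hinj (h0.trans (map_zero _).symm))
  let W : Ideal A :=
    { carrier := {y | ∃ g ∉ P, ∃ q ∈ P, g * algebraMap A R y = algebraMap A R c * q}
      zero_mem' := ⟨1, hP.one_notMem, 0, P.zero_mem, by simp⟩
      add_mem' := by
        rintro y z ⟨g, hg, q, hq, e⟩ ⟨g', hg', q', hq', e'⟩
        refine ⟨g * g', hP.mul_notMem hg hg', g' * q + g * q',
          add_mem (P.mul_mem_left _ hq) (P.mul_mem_left _ hq'), ?_⟩
        rw [map_add]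
        linear_combination g' * e + g * e'
      smul_mem' := by
        rintro x y ⟨g, hg, q, hq, e⟩
        refine ⟨g, hg, algebraMap A R x * q, P.mul_mem_left _ hq, ?_⟩
        rw [smul_eq_mul, map_mul]
        linear_combination algebraMap A R x * e }
  refine ⟨W, fun hle => ?_, fun b hb hbW hle => ?_⟩
  · obtain ⟨g, hg, q, hq, e⟩ := hle hc
    rw [mul_comm] at e
    exact hg (mul_left_cancel₀ hc0 e ▸ hq)
  · obtain ⟨r, hr⟩ := hf' b hb
    refine hbW ⟨f, hfP, r, hle (Submodule.mem_colon.2 ?_), hr⟩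
    rintro _ ⟨j, hj, rfl⟩
    obtain ⟨s, hs⟩ := hf' j hj
    refine Ideal.mem_span_singleton.2 ⟨s, mul_left_cancel₀ hc0 ?_⟩
    rw [smul_eq_mul]
    linear_combination algebraMap A R b * hs - algebraMap A R j * hr

theorem exists_pow_forall_exists_mul_mem {R : Type*} [CommRing R] {M K T : Ideal R} [hM : M.IsPrime]
    (hT : T.FG) (h : ∀ P : Ideal R, P.IsPrime → P ≤ M → K ≤ P → T ≤ P) :
    ∃ n : ℕ, ∀ r ∈ T ^ n, ∃ g ∉ M, g * r ∈ K := by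
  let K' : Ideal R :=
    { carrier := {r | ∃ g ∉ M, g * r ∈ K}
      zero_mem' := ⟨1, hM.one_notMem, by simp⟩
      add_mem' := by
        rintro y z ⟨g, hg, e⟩ ⟨g', hg', e'⟩
        refine ⟨g * g', hM.mul_notMem hg hg', ?_⟩
        have : g * g' * (y + z) = g' * (g * y) + g * (g' * z) := by ring
        rw [this]
        exact add_mem (K.mul_mem_left _ e) (K.mul_mem_left _ e')
      smul_mem' := by
        rintro x y ⟨g, hg, e⟩
        refine ⟨g, hg, ?_⟩
        rw [smul_eq_mul, mul_left_comm]
        exact K.mul_mem_left _ e }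
  refine Ideal.exists_pow_le_of_le_radical_of_fg (J := K') (fun f hf => ?_) hT
  by_contra hfK
  have hd : Disjoint (K : Set R) ↑(M.primeCompl ⊔ Submonoid.powers f) := by
    rw [Set.disjoint_left]
    intro r hr hr'
    obtain ⟨g, hg, _, ⟨n, rfl⟩, rfl⟩ := Submonoid.mem_sup.1 hr'
    exact hfK ⟨n, g, hg, hr⟩
  obtain ⟨P, hP, hKP, hPd⟩ := Ideal.exists_le_prime_disjoint K _ hd
  rw [Set.disjoint_left] at hPd
  refine hPd (h P hP (fun x hx => ?_) hKP hf) (Submonoid.mem_sup_right (Submonoid.mem_powers f))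
  by_contra hxM
  exact hPd hx (Submonoid.mem_sup_left hxM)

theorem dvd_of_dvd_mul_of_forall_notMem {R : Type*} [CommRing R] [IsDomain R] [IsNoetherianRing R]
    [IsIntegrallyClosed R] {T : Ideal R} [T.IsPrime] (hT : T ≠ ⊥) {x y : R} (hx : x ∉ T)
    (hy : ∀ P ∈ (Ideal.span {x}).minimalPrimes, ¬ T ≤ P → y ∉ P) (u : R) (h : x ∣ y * u) :
    x ∣ u := by
  have hx0 : x ≠ 0 := fun h => hx (h ▸ T.zero_mem)
  refine dvd_of_dvd_mul_of_forall_height_le_one hx0 (fun P hP hxP hPh => ?_) h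
  refine hy P (mem_minimalPrimes_span_singleton_of_height_le_one hPh hx0 hxP) fun hTP => ?_
  exact not_height_le_one_of_lt hT (lt_of_le_of_ne hTP fun h => hx (h ▸ hxP)) hPh

/-- If `x, y` is a regular sequence in the prime `M`, the localization at `M` has depth at least
three, and `z ∈ M` is such that no smaller prime contains `x, y, z`, then `z` is locally regular
modulo `x, y`. -/
theorem exists_mul_mem_span_pair {R : Type*} [CommRing R] [IsDomain R] [IsNoetherianRing R]
    (M : Ideal R) [hM : M.IsPrime] {rs : List (Localization.AtPrime M)}
    (hrs : ∀ r ∈ rs, r ∈ IsLocalRing.maximalIdeal (Localization.AtPrime M))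
    (hreg : RingTheory.Sequence.IsWeaklyRegular (Localization.AtPrime M) rs)
    (hlen : 3 ≤ rs.length) {x y z : R} (hx0 : x ≠ 0) (hy : y ∈ M)
    (hxy : ∀ u, x ∣ y * u → x ∣ u)
    (hP : ∀ P : Ideal R, P.IsPrime → P ≤ M → x ∈ P → y ∈ P → z ∈ P → P = M) {u : R}
    (hu : z * u ∈ Ideal.span {x, y}) : ∃ g ∉ M, g * u ∈ Ideal.span {x, y} := by
  let L := Localization.AtPrime M
  let f := algebraMap R L
  have hinj : Function.Injective f := IsLocalization.injective L M.primeCompl_le_nonZeroDivisors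
  have hspan : (Ideal.span {x, y}).map f = Ideal.span {f x, f y} := by
    rw [Ideal.map_span, Set.image_pair]
  have hmax : IsLocalRing.maximalIdeal L = M.map f :=
    (Localization.AtPrime.map_eq_maximalIdeal (I := M)).symm
  suffices hmem : f u ∈ Ideal.span {f x, f y} by
    rw [← hspan, IsLocalization.mem_map_algebraMap_iff M.primeCompl] at hmem
    obtain ⟨⟨⟨v, hv⟩, g⟩, e⟩ := hmem
    refine ⟨g, g.2, ?_⟩
    rw [mul_comm, hinj ((map_mul f _ _).trans e)]
    exact hv
  by_contra hnot
  have hfz : f z * f u ∈ Ideal.span {f x, f y} := by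
    rw [← hspan, ← map_mul]
    exact Ideal.mem_map_of_mem f hu
  obtain ⟨P, hPp, hzP, w, hw, hPw⟩ := exists_prime_eq_colon _ hnot hfz
  have hcomap : P.comap f = M := by
    refine hP _ (hPp.comap f) ?_ ?_ ?_ hzP
    · intro r hr
      have := IsLocalRing.le_maximalIdeal hPp.ne_top hr
      rwa [← IsLocalization.AtPrime.under_maximalIdeal L M]
    · exact (hPw _).2 (Ideal.mul_mem_right _ _ (Ideal.subset_span (by simp)))
    · exact (hPw _).2 (Ideal.mul_mem_right _ _ (Ideal.subset_span (by simp)))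
  refine hw (mem_span_pair_of_isWeaklyRegular hrs hreg hlen (fun h => hx0 ?_) ?_ ?_ ?_)
  · exact hinj (h.trans (map_zero f).symm)
  · rw [hmax]
    exact Ideal.mem_map_of_mem f hy
  · rintro v ⟨v', hv⟩
    obtain ⟨⟨r, s⟩, hr⟩ := IsLocalization.surj M.primeCompl v
    obtain ⟨⟨r', s'⟩, hr'⟩ := IsLocalization.surj M.primeCompl v'
    change v * f s = f r at hr
    change v' * f s' = f r' at hr'
    have e : y * (r * s') = x * (r' * s) := hinj <| by
      simp only [map_mul, ← hr, ← hr']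
      linear_combination f s * f s' * hv
    obtain ⟨q, hq⟩ := hxy _ ⟨_, e⟩
    have hs : IsUnit (f s * f s') :=
      (IsLocalization.map_units L s).mul (IsLocalization.map_units L s')
    rw [← hs.dvd_mul_right]
    refine ⟨f q, ?_⟩
    rw [← map_mul f x q, ← hq, map_mul, ← hr]
    ring
  · intro m hm
    rw [← hPw]
    rw [hmax] at hm
    exact Ideal.map_le_iff_le_comap.2 hcomap.ge hm

open Polynomial in
/-- The inclusion of `I` as the degree one part of its Rees algebra. -/
noncomputable def reesAlgebraDegreeOne {A : Type*} [CommRing A] (I : Ideal A) :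
    I →ₗ[A] reesAlgebra I where
  toFun x := ⟨monomial 1 (x : A), reesAlgebra.monomial_mem.2 (by simp)⟩
  map_add' x y := Subtype.ext (by simp)
  map_smul' c x := Subtype.ext (by simp [smul_monomial])

/-- The projection of the Rees algebra onto its degree zero part. -/
noncomputable def reesAlgebraDegreeZero {A : Type*} [CommRing A] (I : Ideal A) :
    reesAlgebra I →+* A :=
  Polynomial.constantCoeff.comp (reesAlgebra I).val.toRingHom

section

open Polynomial

variable {A : Type*} [CommRing A] {I : Ideal A}

theorem reesAlgebraDegreeZero_apply (r : reesAlgebra I) :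
    reesAlgebraDegreeZero I r = (r : A[X]).coeff 0 := rfl

theorem coe_reesAlgebraDegreeOne (x : I) :
    (reesAlgebraDegreeOne I x : A[X]) = monomial 1 (x : A) := rfl

theorem coe_algebraMap_reesAlgebra (x : A) : (algebraMap A (reesAlgebra I) x : A[X]) = C x := rfl

theorem reesAlgebra_coeff_mem (r : reesAlgebra I) (n : ℕ) : (r : A[X]).coeff n ∈ I ^ n :=
  (mem_reesAlgebra_iff I _).1 r.2 n

theorem reesAlgebraDegreeZero_algebraMap (x : A) :
    reesAlgebraDegreeZero I (algebraMap A _ x) = x := by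
  rw [reesAlgebraDegreeZero_apply, coe_algebraMap_reesAlgebra, coeff_C_zero]

theorem reesAlgebraDegreeZero_degreeOne (x : I) :
    reesAlgebraDegreeZero I (reesAlgebraDegreeOne I x) = 0 := by
  rw [reesAlgebraDegreeZero_apply, coe_reesAlgebraDegreeOne, coeff_monomial_of_ne _ (by decide)]

theorem monomial_mem_span_range_pow (n : ℕ) {x : A} (hx : x ∈ I ^ n) :
    (⟨monomial n x, reesAlgebra.monomial_mem.2 hx⟩ : reesAlgebra I) ∈
      Ideal.span (Set.range (reesAlgebraDegreeOne I)) ^ n := by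
  induction n generalizing x with
  | zero => simp
  | succ n ih =>
    suffices h : ∀ z ∈ I * I ^ n, ∃ h : monomial (n + 1) z ∈ reesAlgebra I,
        (⟨monomial (n + 1) z, h⟩ : reesAlgebra I) ∈
          Ideal.span (Set.range (reesAlgebraDegreeOne I)) ^ (n + 1) from
      (h x (by rwa [pow_succ'] at hx)).2
    intro z hz
    induction hz using Submodule.mul_induction_on' with
    | mem_mul_mem y hy z hz =>
      have hyz : monomial (n + 1) (y * z) ∈ reesAlgebra I :=
        reesAlgebra.monomial_mem.2 (by rw [pow_succ']; exact Ideal.mul_mem_mul hy hz)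
      refine ⟨hyz, ?_⟩
      have e : (⟨monomial (n + 1) (y * z), hyz⟩ : reesAlgebra I) = reesAlgebraDegreeOne I ⟨y, hy⟩ *
          ⟨monomial n z, reesAlgebra.monomial_mem.2 hz⟩ := Subtype.ext <| by
        change monomial (n + 1) (y * z) = monomial 1 y * monomial n z
        rw [monomial_mul_monomial, add_comm]
      rw [e, pow_succ']
      exact Ideal.mul_mem_mul (Ideal.subset_span ⟨_, rfl⟩) (ih hz)
    | add y _ z _ h h' =>
      obtain ⟨h₁, h₂⟩ := h
      obtain ⟨h₁', h₂'⟩ := h'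
      refine ⟨by rw [map_add]; exact add_mem h₁ h₁', ?_⟩
      convert add_mem h₂ h₂' using 1
      exact Subtype.ext (map_add _ _ _)

theorem ker_reesAlgebraDegreeZero :
    RingHom.ker (reesAlgebraDegreeZero I) = Ideal.span (Set.range (reesAlgebraDegreeOne I)) := by
  refine le_antisymm (fun r hr => ?_) (Ideal.span_le.2 ?_)
  · have e : r = ∑ i ∈ (r : A[X]).support, (⟨monomial i ((r : A[X]).coeff i),
        reesAlgebra.monomial_mem.2 (reesAlgebra_coeff_mem r i)⟩ : reesAlgebra I) := by
      apply Subtype.ext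
      rw [AddSubmonoidClass.coe_finsetSum]
      exact (r : A[X]).as_sum_support
    rw [e]
    refine Ideal.sum_mem _ fun i hi => ?_
    refine Ideal.pow_le_self ?_ (monomial_mem_span_range_pow i (reesAlgebra_coeff_mem r i))
    rintro rfl
    exact (mem_support_iff.1 hi) hr
  · rintro _ ⟨x, rfl⟩
    exact reesAlgebraDegreeZero_degreeOne x

theorem map_sup_ker_reesAlgebraDegreeZero (m : Ideal A) :
    m.map (algebraMap A (reesAlgebra I)) ⊔ RingHom.ker (reesAlgebraDegreeZero I) =
      m.comap (reesAlgebraDegreeZero I) := by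
  refine le_antisymm (sup_le (Ideal.map_le_iff_le_comap.2 fun x hx => ?_) fun r hr => ?_)
    fun r hr => ?_
  · rwa [Ideal.mem_comap, Ideal.mem_comap, reesAlgebraDegreeZero_algebraMap]
  · rw [Ideal.mem_comap, (RingHom.mem_ker).1 hr]
    exact m.zero_mem
  · rw [← add_sub_cancel (algebraMap A _ (reesAlgebraDegreeZero I r)) r]
    refine Submodule.add_mem_sup (Ideal.mem_map_of_mem _ hr) ?_
    rw [RingHom.mem_ker, map_sub, reesAlgebraDegreeZero_algebraMap, sub_self]

theorem degreeOne_mul_algebraMap_mem {a : I} {x : A} (hx : x ∈ I ^ 2) {a' : I} (hxI : x ∈ I) :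
    (reesAlgebraDegreeOne I a + algebraMap A _ (a' : A)) * reesAlgebraDegreeOne I ⟨x, hxI⟩ ∈
      Ideal.span {algebraMap A (reesAlgebra I) a, reesAlgebraDegreeOne I a'} := by
  refine Ideal.mem_span_pair.2 ⟨⟨monomial 2 x, reesAlgebra.monomial_mem.2 hx⟩,
    algebraMap A _ x, Subtype.ext ?_⟩
  change monomial 2 x * C (a : A) + C x * monomial 1 (a' : A) =
    (monomial 1 (a : A) + C (a' : A)) * monomial 1 x
  rw [add_mul, monomial_mul_monomial, C_mul_monomial, C_mul_monomial, monomial_mul_C]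
  ring_nf

theorem exists_eq_add_of_mul_degreeOne_mem [IsLocalRing A] {a a' : I}
    (ha0 : (a : A) ∈ nonZeroDivisors A)
    (hdvd : ∀ u : reesAlgebra I, algebraMap A _ (a : A) ∣ reesAlgebraDegreeOne I a' * u →
      algebraMap A _ (a : A) ∣ u) {x : A} (hx : x ∈ I ^ 2) {hxI : x ∈ I} {g : reesAlgebra I}
    (hg : g ∉ (IsLocalRing.maximalIdeal A).comap (reesAlgebraDegreeZero I))
    (h : g * reesAlgebraDegreeOne I ⟨x, hxI⟩ ∈
      Ideal.span {algebraMap A (reesAlgebra I) a, reesAlgebraDegreeOne I a'}) :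
    ∃ y ∈ I, ∃ w ∈ I, x = a * y + a' * w := by
  obtain ⟨α, β, e⟩ := Ideal.mem_span_pair.1 h
  have e₁ : (α : A[X]) * C (a : A) + (β : A[X]) * monomial 1 (a' : A) =
    (g : A[X]) * monomial 1 x := congrArg Subtype.val e
  have e₂ := congrArg (fun p => coeff p (0 + 1)) e₁
  simp only [coeff_add, coeff_mul_C, coeff_mul_monomial] at e₂
  obtain ⟨u, hu⟩ : IsUnit ((g : A[X]).coeff 0) := by
    simpa [reesAlgebraDegreeZero_apply] using hg
  rw [← hu] at e₂
  have hα : (α : A[X]).coeff (0 + 1) ∈ I := by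
    simpa using reesAlgebra_coeff_mem α 1
  have e₃ : x = a * (↑u⁻¹ * (α : A[X]).coeff (0 + 1)) + a' * (↑u⁻¹ * (β : A[X]).coeff 0) := by
    linear_combination (-x) * u.inv_mul - ↑u⁻¹ * e₂
  refine ⟨_, I.mul_mem_left _ hα, _, ?_, e₃⟩
  set w := ↑u⁻¹ * (β : A[X]).coeff 0
  have hw2 : a' * w ∈ I ^ 2 := by
    have : (a' : A) * w = x - a * (↑u⁻¹ * (α : A[X]).coeff (0 + 1)) := by
      linear_combination -e₃
    rw [this, pow_two]
    exact sub_mem (pow_two I ▸ hx) (Ideal.mul_mem_mul a.2 (I.mul_mem_left _ hα))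
  obtain ⟨r, hr⟩ := hdvd (w • reesAlgebraDegreeOne I a)
    ⟨⟨monomial 2 (a' * w), reesAlgebra.monomial_mem.2 hw2⟩, Subtype.ext <| by
      change monomial 1 (a' : A) * (w • monomial 1 (a : A)) = C (a : A) * monomial 2 (a' * w)
      rw [smul_monomial, monomial_mul_monomial, C_mul_monomial, smul_eq_mul]
      ring_nf⟩
  have hr' : w • monomial 1 (a : A) = C (a : A) * (r : A[X]) := congrArg Subtype.val hr
  have hr₁ := congrArg (fun p => coeff p 1) hr'
  simp only [coeff_smul, coeff_monomial_same, coeff_C_mul, smul_eq_mul] at hr₁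
  rw [mul_comm] at hr₁
  rw [(mul_cancel_left_mem_nonZeroDivisors ha0).1 hr₁]
  simpa using reesAlgebra_coeff_mem r 1

theorem exists_eq_add_of_mul_monomial_mem [IsLocalRing A] {J : Ideal A} {a : I} {b : A} {n : ℕ}
    (h : ∀ r ∈ Ideal.span (Set.range (reesAlgebraDegreeOne I)) ^ (n + 1),
      ∃ g ∉ (IsLocalRing.maximalIdeal A).comap (reesAlgebraDegreeZero I),
        g * r ∈ Ideal.span {reesAlgebraDegreeOne I a} ⊔
          (Ideal.span {algebraMap A _ b}).colon (algebraMap A _ '' J)) :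
    ∀ z ∈ I ^ (n + 1) * J, ∃ s ∈ I ^ n * J, ∃ w ∈ I ^ (n + 1), z = a * s + b * w := by
  intro z hz
  induction hz using Submodule.mul_induction_on' with
  | mem_mul_mem s hs j hj =>
    obtain ⟨g, hg, hgs⟩ := h _ (monomial_mem_span_range_pow _ hs)
    obtain ⟨_, hr, f, hf, e⟩ := Submodule.mem_sup.1 hgs
    obtain ⟨r, rfl⟩ := Ideal.mem_span_singleton.1 hr
    obtain ⟨v, hv⟩ := Ideal.mem_span_singleton.1 (Submodule.mem_colon.1 hf _ ⟨j, hj, rfl⟩)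
    have e₁ : monomial 1 (a : A) * (r : A[X]) + (f : A[X]) = (g : A[X]) * monomial (n + 1) s :=
      congrArg Subtype.val e
    have hv₁ : (f : A[X]) * C j = C b * (v : A[X]) := congrArg Subtype.val hv
    have e₂ := congrArg (fun p => coeff p (n + 1)) e₁
    have hv₂ := congrArg (fun p => coeff p (n + 1)) hv₁
    have e₃ := coeff_mul_monomial (g : A[X]) (n + 1) 0 s
    rw [zero_add] at e₃
    simp only [coeff_add, coeff_monomial_mul, e₃] at e₂
    simp only [coeff_mul_C, coeff_C_mul] at hv₂
    obtain ⟨u, hu⟩ : IsUnit ((g : A[X]).coeff 0) := by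
      simpa [reesAlgebraDegreeZero_apply] using hg
    rw [← hu] at e₂
    refine ⟨(r : A[X]).coeff n * (↑u⁻¹ * j), Ideal.mul_mem_mul (reesAlgebra_coeff_mem r n)
      (J.mul_mem_left _ hj), ↑u⁻¹ * (v : A[X]).coeff (n + 1),
      Ideal.mul_mem_left _ _ (reesAlgebra_coeff_mem v _), ?_⟩
    linear_combination (-s * j) * u.inv_mul - ↑u⁻¹ * j * e₂ + ↑u⁻¹ * hv₂
  | add y _ z _ h h' =>
    obtain ⟨s, hs, w, hw, rfl⟩ := h
    obtain ⟨s', hs', w', hw', rfl⟩ := h'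
    exact ⟨s + s', add_mem hs hs', w + w', add_mem hw hw', by ring⟩

end

theorem exists_isPrime_lt_maximalIdeal {A : Type*} [CommRing A] [IsDomain A] [IsNoetherianRing A]
    [IsLocalRing A] (hdim : ringKrullDim A = 2) :
    ∃ p : Ideal A, p.IsPrime ∧ p ≠ ⊥ ∧ p < IsLocalRing.maximalIdeal A := by
  have h2 := two_le_height_maximalIdeal hdim
  obtain ⟨x, hx, hx0⟩ := Submodule.exists_mem_ne_zero_of_ne_bot
    (p := IsLocalRing.maximalIdeal A) fun h => h2 (by rw [h]; simp)
  obtain ⟨p, hp, hpm⟩ := Ideal.exists_minimalPrimes_le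
    ((Ideal.span_singleton_le_iff_mem _).2 hx)
  refine ⟨p, hp.1.1, ?_, lt_of_le_of_ne hpm ?_⟩
  · exact (Submodule.ne_bot_iff _).2 ⟨x, (Ideal.span_singleton_le_iff_mem _).1 hp.1.2, hx0⟩
  · rintro rfl
    exact h2 (Ideal.height_le_one_of_isPrincipal_of_mem_minimalPrimes _ _ hp)

theorem three_le_height_comap_maximalIdeal {A : Type*} [CommRing A] [IsDomain A]
    [IsNoetherianRing A] [IsLocalRing A] (hdim : ringKrullDim A = 2) {I : Ideal A} (hI : I ≠ ⊥) :
    3 ≤ ((IsLocalRing.maximalIdeal A).comap (reesAlgebraDegreeZero I)).height := by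
  obtain ⟨p, hp, hp0, hpm⟩ := exists_isPrime_lt_maximalIdeal hdim
  have hsurj : Function.Surjective (reesAlgebraDegreeZero I) := fun x =>
    ⟨algebraMap A _ x, reesAlgebraDegreeZero_algebraMap x⟩
  have hlt : ∀ {q q' : Ideal A}, q < q' → q.comap (reesAlgebraDegreeZero I) <
      q'.comap (reesAlgebraDegreeZero I) := fun h =>
    lt_of_le_not_ge (Ideal.comap_mono h.le) fun h' =>
      h.not_ge ((Ideal.comap_le_comap_iff_of_surjective _ hsurj _ _).1 h')
  have := (Ideal.isPrime_bot (α := A)).comap (reesAlgebraDegreeZero I)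
  have := hp.comap (reesAlgebraDegreeZero I)
  refine three_le_height_of_lt_of_lt ?_ (hlt (bot_lt_iff_ne_bot.2 hp0)) (hlt hpm)
  obtain ⟨x, hx, hx0⟩ := Submodule.exists_mem_ne_zero_of_ne_bot hI
  refine (Submodule.ne_bot_iff _).2 ⟨reesAlgebraDegreeOne I ⟨x, hx⟩, ?_, fun h => hx0 ?_⟩
  · exact reesAlgebraDegreeZero_degreeOne _
  · exact (Polynomial.monomial_eq_zero_iff _ _).1 (congrArg Subtype.val h)

/-- joint reduction property of `p_g`-ideals.
If the Rees algebra of the `𝔪`-primary ideal `I` is a Cohen–Macaulay normal domain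
(i.e. `I` is a `p_g`-ideal) and `J` is any integrally closed `𝔪`-primary ideal, then
`IJ = aJ + bI` for suitable `a ∈ I`, `b ∈ J`. -/
theorem stmt4 (k : Type*) [Field k] [IsAlgClosed k]
    (A : Type*) [CommRing A] [IsDomain A] [IsNoetherianRing A] [IsLocalRing A]
    [Algebra k A] [IsIntegrallyClosed A]
    (hdim : ringKrullDim A = 2)
    (I : Ideal A) (hIprim : ∃ n : ℕ, IsLocalRing.maximalIdeal A ^ n ≤ I)
    (hIrees : IsCMNormalDomain (reesAlgebra I))
    (J : Ideal A) (hJprim : ∃ n : ℕ, IsLocalRing.maximalIdeal A ^ n ≤ J)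
    (hJcl : IdealIsIntegrallyClosed J) :
    ∃ a ∈ I, ∃ b ∈ J, I * J = Ideal.span {a} * J ⊔ Ideal.span {b} * I := by
  rcases eq_or_ne I ⊤ with rfl | hItop
  · exact ⟨1, trivial, 0, J.zero_mem, by simp⟩
  obtain ⟨⟨hRN, hCM⟩, hRD, hRI⟩ := hIrees
  have hI' : I ≤ IsLocalRing.maximalIdeal A := IsLocalRing.le_maximalIdeal hItop
  have hm0 : IsLocalRing.maximalIdeal A ≠ ⊥ := fun h =>
    two_le_height_maximalIdeal hdim (by rw [h]; simp)
  have ne_bot : ∀ {K : Ideal A}, (∃ n : ℕ, IsLocalRing.maximalIdeal A ^ n ≤ K) → K ≠ ⊥ := by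
    rintro _ ⟨n, hn⟩ rfl
    exact pow_ne_zero n hm0 (le_bot_iff.1 hn)
  have hI0 := ne_bot hIprim
  have hinj : Function.Injective (algebraMap A (reesAlgebra I)) :=
    Function.LeftInverse.injective reesAlgebraDegreeZero_algebraMap
  have hdimR : ringKrullDim (reesAlgebra I) ≤ 3 := by
    refine (ringKrullDim_reesAlgebra_le hI0).trans ?_
    rw [hdim]
    exact le_of_eq (by norm_num)
  have hm : (IsLocalRing.maximalIdeal A).map (algebraMap A (reesAlgebra I)) ≠ ⊥ := by
    rwa [Ne, Ideal.map_eq_bot_iff_of_injective hinj]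
  set τ := reesAlgebraDegreeOne I with hτ
  have hker : RingHom.ker (reesAlgebraDegreeZero I) = Ideal.span (Set.range τ) :=
    ker_reesAlgebraDegreeZero
  have hTprime : (Ideal.span (Set.range τ)).IsPrime := hker ▸ RingHom.ker_isPrime _
  set M := (IsLocalRing.maximalIdeal A).comap (reesAlgebraDegreeZero I) with hM
  have hMsup : (IsLocalRing.maximalIdeal A).map (algebraMap A (reesAlgebra I)) ⊔
      Ideal.span (Set.range τ) = M := by
    rw [hM, ← map_sup_ker_reesAlgebraDegreeZero, hker]
  have hMprime : M.IsPrime := (IsLocalRing.maximalIdeal.isMaximal A).isPrime.comap _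
  have hTM : Ideal.span (Set.range τ) ≤ M := hMsup ▸ le_sup_right
  have hfin := Ideal.finite_minimalPrimes_of_isNoetherianRing (reesAlgebra I)
  obtain ⟨a, haS, ha0⟩ := exists_forall_notMem_and_forall_notMem k τ
    ((hfin ((IsLocalRing.maximalIdeal A).map (algebraMap A (reesAlgebra I)))).union
      (hfin (⨆ c ∈ J, (Ideal.span {algebraMap A (reesAlgebra I) c}).colon
        (algebraMap A (reesAlgebra I) '' J))))
    (Set.finite_singleton (⊥ : Ideal A)) (by simpa using hI0)
  have ha0 : (a : A) ≠ 0 := by simpa using ha0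
  have hτ0 : ∀ x : I, (x : A) ≠ 0 → τ x ≠ 0 := fun x hx h =>
    hx ((Polynomial.monomial_eq_zero_iff _ _).1 (congrArg Subtype.val h))
  have haT : algebraMap A (reesAlgebra I) a ∉ Ideal.span (Set.range τ) := by
    rw [← hker, RingHom.mem_ker, reesAlgebraDegreeZero_algebraMap]
    exact ha0
  have hT0 : Ideal.span (Set.range τ) ≠ ⊥ :=
    (Submodule.ne_bot_iff _).2 ⟨_, Ideal.subset_span ⟨a, rfl⟩, hτ0 a ha0⟩
  obtain ⟨a', haS', ha'⟩ := exists_forall_notMem_and_forall_notMem k τ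
    ((hfin ((IsLocalRing.maximalIdeal A).map (algebraMap A (reesAlgebra I)) ⊔
      Ideal.span {τ a})).union (hfin (Ideal.span {algebraMap A (reesAlgebra I) a})))
    (Ideal.finite_minimalPrimes_of_isNoetherianRing A (Ideal.span {(a : A)}))
    fun p hp => not_le_of_mem_minimalPrimes_span_singleton hdim hIprim hp
  have ham := fun P hP => haS P (Or.inl hP)
  have ham' := fun P hP => haS' P (Or.inl hP)
  have hdvd := dvd_of_dvd_mul_of_forall_notMem hT0 haT fun P hP => haS' P (Or.inr hP)
  let F := {P ∈ ((IsLocalRing.maximalIdeal A).map (algebraMap A (reesAlgebra I)) ⊔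
    Ideal.span {τ a}).minimalPrimes | ¬ Ideal.span (Set.range τ) ≤ P ∧ P ≤ M}
  have hW : ∀ P : F, ∃ W : Ideal A, ¬ J ≤ W ∧ ∀ b ∈ J, b ∉ W →
      ¬ (Ideal.span {algebraMap A (reesAlgebra I) b}).colon
        (algebraMap A (reesAlgebra I) '' J) ≤ P := by
    rintro ⟨P, hP, hTP, hPM⟩
    have := hP.1.1
    exact exists_ideal_not_le_and_not_colon_le hinj (ne_bot hJprim) P
      (not_iSup_colon_le hdimR hm hTM hIprim hI' hJprim ham (fun P hP => haS P (Or.inr hP))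
        hP hTP hPM)
  choose W hWJ hWb using hW
  have hFfin : Finite F := (hfin _).subset (Set.sep_subset _ _)
  obtain ⟨b, hb, hbS⟩ := exists_mem_forall_notMem_of_infinite k J
    ((Set.finite_range W).union
      (Ideal.finite_minimalPrimes_of_isNoetherianRing A (Ideal.span {(a : A)}))) <| by
    rintro p (⟨P, rfl⟩ | hp)
    · exact hWJ P
    · exact not_le_of_mem_minimalPrimes_span_singleton hdim hJprim hp
  obtain ⟨N, hN⟩ := exists_pow_forall_exists_mul_mem (M := M)
    (K := Ideal.span {τ a} ⊔ (Ideal.span {algebraMap A (reesAlgebra I) b}).colon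
      (algebraMap A (reesAlgebra I) '' J))
    (IsNoetherian.noetherian (Ideal.span (Set.range τ))) fun P hP hPM hKP => by
      refine span_range_le_of_colon_le hdim hdimR hm hTM ha0 ham
        (fun q hq => hbS q (Or.inr hq)) (fun Q hQ hTQ hQM => ?_) hPM
        ((Ideal.span_singleton_le_iff_mem _).1 (le_sup_left.trans hKP))
        (le_sup_right.trans hKP)
      exact hWb ⟨Q, hQ, hTQ, hQM⟩ b hb (hbS _ (Or.inl ⟨_, rfl⟩))
  obtain ⟨-, hL, rs, hrs, hreg, hlen⟩ := hCM M hMprime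
  have hlen3 : 3 ≤ rs.length := by
    rw [IsLocalization.AtPrime.ringKrullDim_eq_height M] at hlen
    have h3 : (3 : ℕ∞) ≤ rs.length :=
      (three_le_height_comap_maximalIdeal hdim hI0).trans (WithBot.coe_le_coe.1 hlen.ge)
    exact_mod_cast h3
  refine ⟨a, a.2, b, hb, mul_eq_span_mul_sup_of_pow hJcl a.2 ha0 hb (a' := a') ?_ a'.2 ?_ N
    (exists_eq_add_of_mul_monomial_mem fun r hr => hN r (Ideal.pow_le_pow_right N.le_succ hr))⟩
  · intro x hx
    have hxI : x ∈ I := Ideal.pow_le_self two_ne_zero hx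
    have hPeq : ∀ P : Ideal (reesAlgebra I), P.IsPrime → P ≤ M → algebraMap A _ (a : A) ∈ P →
        τ a' ∈ P → τ a + algebraMap A _ (a' : A) ∈ P → P = M := by
      intro P hP hPM haP haP' hzP
      have hτa : τ a ∈ P := by
        refine hP.mem_of_pow_mem 2 ?_
        have e : τ a * algebraMap A _ (a' : A) = algebraMap A _ (a : A) * τ a' := by
          rw [mul_comm, ← Algebra.smul_def, ← Algebra.smul_def, ← map_smul, ← map_smul]
          exact congrArg τ (Subtype.ext (mul_comm _ _))
        have e' : τ a ^ 2 = τ a * (τ a + algebraMap A _ (a' : A)) -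
            algebraMap A _ (a : A) * τ a' := by
          linear_combination -e
        rw [e']
        exact sub_mem (P.mul_mem_left _ hzP) (P.mul_mem_left _ haP')
      have ha'P : algebraMap A _ (a' : A) ∈ P := (P.add_mem_iff_right hτa).1 hzP
      have hmP : (IsLocalRing.maximalIdeal A).map (algebraMap A (reesAlgebra I)) ≤ P := by
        rw [Ideal.map_le_iff_le_comap]
        exact (eq_maximalIdeal_of_mem_of_mem hdim ha0 ha'
          (p := P.comap (algebraMap A (reesAlgebra I))) haP ha'P).ge
      refine le_antisymm hPM (hMsup ▸ sup_le hmP ?_)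
      exact span_range_le_of_mem_of_mem hdimR hm hTM ham ham' hPM hmP hτa haP'
    obtain ⟨g, hg, hgx⟩ := exists_mul_mem_span_pair M hrs hreg.toIsWeaklyRegular hlen3
      (fun h => ha0 (hinj (h.trans (map_zero _).symm))) (hTM (Ideal.subset_span ⟨a', rfl⟩)) hdvd
      hPeq (degreeOne_mul_algebraMap_mem hx hxI)
    exact exists_eq_add_of_mul_degreeOne_mem (mem_nonZeroDivisors_of_ne_zero ha0) hdvd hx hg hgx
  · intro u hu
    by_contra hc
    obtain ⟨p, hp, hpa', w, hw, hpw⟩ := exists_prime_eq_colon (Ideal.span {(a : A)})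
      (by rwa [Ideal.mem_span_singleton]) (Ideal.mem_span_singleton.2 hu)
    simp only [Ideal.mem_span_singleton] at hw hpw
    exact ha' p (mem_minimalPrimes_span_singleton_of_height_le_one
      (height_le_one_of_eq_colon ha0 hw p hpw) ha0 ((hpw _).2 (dvd_mul_right _ _))) hpa'
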